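/- arXiv:1601.06758 — 2 statements merged into one kernel-verified Lean document; each statement's English description precedes it below -/
import Mathlib

section
/- Let G be an n×n real matrix, P an invertible n×n real matrix with P⁻¹ * G * P = Λ where Λ is diagonal with diagonal entries λ₁,…,λₙ, and let B, H be m×m real matrices, σ, τ ∈ ℝ. Suppose ξ : ℝ → (Fin n × Fin m → ℝ) is differentiable and satisfies the full variational equation ξ'(t) = (I_n ⊗ B).mulVec ξ(t) + σ • (G ⊗ H).mulVec ξ(t−τ) for all t. Then the transformed function η(t) = (P⁻¹ ⊗ I_m).mulVec ξ(t) is differentiable and decouples into n independent m-dimensional modes: for each i = 1,…,n, the block ηᵢ(t) = (j ↦ η(t)(i,j)) satisfies ηᵢ'(t) = B.mulVec ηᵢ(t) + (σ·λᵢ) • H.mulVec ηᵢ(t−τ) for all t. Conversely, if η satisfies the decoupled equations then ξ(t) = (P ⊗ I_m).mulVec η(t) satisfies the full variational equation. -/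
open Matrix Kronecker

/-- A constant matrix maps a differentiable curve to a differentiable curve. -/
theorem HasDerivAt.const_mulVec {ι κ : Type*} [Fintype ι] [Fintype κ]
    (A : Matrix κ ι ℝ) {f : ℝ → ι → ℝ} {f' : ι → ℝ} {t : ℝ} (hf : HasDerivAt f f' t) :
    HasDerivAt (fun s => A.mulVec (f s)) (A.mulVec f') t :=
  (LinearMap.toContinuousLinearMap A.mulVecLin).hasFDerivAt.comp_hasDerivAt t hf

/-- If `Q` intertwines the coupling matrices `G` and `L`, then `Q ⊗ I` maps solutions of the
variational equation with coupling `G` to solutions of the one with coupling `L`. -/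
theorem HasDerivAt.kronecker_one_mulVec {ι κ : Type*} [Fintype ι] [Fintype κ]
    [DecidableEq ι] [DecidableEq κ] {G L Q : Matrix ι ι ℝ} (hQ : Q * G = L * Q)
    (B H : Matrix κ κ ℝ) (σ τ : ℝ) {x : ℝ → ι × κ → ℝ} {t : ℝ}
    (hx : HasDerivAt x (((1 : Matrix ι ι ℝ) ⊗ₖ B).mulVec (x t)
      + σ • (G ⊗ₖ H).mulVec (x (t - τ))) t) :
    HasDerivAt (fun s => (Q ⊗ₖ (1 : Matrix κ κ ℝ)).mulVec (x s))
      (((1 : Matrix ι ι ℝ) ⊗ₖ B).mulVec ((Q ⊗ₖ (1 : Matrix κ κ ℝ)).mulVec (x t))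
        + σ • (L ⊗ₖ H).mulVec ((Q ⊗ₖ (1 : Matrix κ κ ℝ)).mulVec (x (t - τ)))) t := by
  convert hx.const_mulVec (Q ⊗ₖ (1 : Matrix κ κ ℝ)) using 1
  simp only [mulVec_add, mulVec_smul, mulVec_mulVec, ← mul_kronecker_mul, Matrix.one_mul,
    Matrix.mul_one, hQ]

/-- The `i`-th block of `(L ⊗ H) v` for a diagonal matrix `L`. -/
theorem Matrix.IsDiag.kronecker_mulVec_apply {ι κ R : Type*} [Fintype ι] [Fintype κ]
    [CommSemiring R] {L : Matrix ι ι R} (hL : L.IsDiag) (H : Matrix κ κ R) (v : ι × κ → R)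
    (i : ι) (j : κ) :
    (L ⊗ₖ H).mulVec v (i, j) = L i i * H.mulVec (fun k => v (i, k)) j := by
  simp only [mulVec, dotProduct, Fintype.sum_prod_type, kroneckerMap_apply, Finset.mul_sum,
    mul_assoc]
  refine Fintype.sum_eq_single i fun k hk => ?_
  simp [hL hk.symm]

/-- For a diagonal coupling matrix, the variational equation is equivalent to the system of its
blocks. -/
theorem Matrix.IsDiag.hasDerivAt_iff_blocks {ι κ : Type*} [Fintype ι] [Fintype κ]
    [DecidableEq ι] {L : Matrix ι ι ℝ} (hL : L.IsDiag)
    (B H : Matrix κ κ ℝ) (σ τ : ℝ) (x : ℝ → ι × κ → ℝ) (t : ℝ) :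
    HasDerivAt x (((1 : Matrix ι ι ℝ) ⊗ₖ B).mulVec (x t)
        + σ • (L ⊗ₖ H).mulVec (x (t - τ))) t ↔
      ∀ i, HasDerivAt (fun s j => x s (i, j))
        (B.mulVec (fun j => x t (i, j))
          + (σ * L i i) • H.mulVec (fun j => x (t - τ) (i, j))) t := by
  simp only [hasDerivAt_pi, Prod.forall, Pi.add_apply, Pi.smul_apply, smul_eq_mul,
    isDiag_one.kronecker_mulVec_apply, hL.kronecker_mulVec_apply, one_apply_eq, one_mul,
    mul_assoc]

/-- Decoupling of the full variational equation of the delay-coupled network into `n`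
independent `m`-dimensional modes via the change of variables `η = (P⁻¹ ⊗ I_m) ξ`,
together with the converse direction `ξ = (P ⊗ I_m) η`. -/
theorem variational_equation_decoupling (n m : ℕ)
    (G P L : Matrix (Fin n) (Fin n) ℝ) (hP : IsUnit P.det)
    (hLdiag : L.IsDiag) (hL : P⁻¹ * G * P = L)
    (B H : Matrix (Fin m) (Fin m) ℝ) (σ τ : ℝ) :
    (∀ ξ : ℝ → (Fin n × Fin m → ℝ),
      (∀ t, HasDerivAt ξ
          (((1 : Matrix (Fin n) (Fin n) ℝ) ⊗ₖ B).mulVec (ξ t)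
            + σ • (G ⊗ₖ H).mulVec (ξ (t - τ))) t) →
      (Differentiable ℝ
          (fun t => (P⁻¹ ⊗ₖ (1 : Matrix (Fin m) (Fin m) ℝ)).mulVec (ξ t)) ∧
        ∀ (i : Fin n) (t : ℝ),
          HasDerivAt
            (fun t => fun j =>
              (P⁻¹ ⊗ₖ (1 : Matrix (Fin m) (Fin m) ℝ)).mulVec (ξ t) (i, j))
            (B.mulVec (fun j =>
                (P⁻¹ ⊗ₖ (1 : Matrix (Fin m) (Fin m) ℝ)).mulVec (ξ t) (i, j))
              + (σ * L i i) • H.mulVec (fun j =>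
                (P⁻¹ ⊗ₖ (1 : Matrix (Fin m) (Fin m) ℝ)).mulVec (ξ (t - τ)) (i, j))) t))
    ∧
    (∀ η : ℝ → (Fin n × Fin m → ℝ),
      (∀ (i : Fin n) (t : ℝ),
        HasDerivAt (fun t => fun j => η t (i, j))
          (B.mulVec (fun j => η t (i, j))
            + (σ * L i i) • H.mulVec (fun j => η (t - τ) (i, j))) t) →
      ∀ t, HasDerivAt
          (fun t => (P ⊗ₖ (1 : Matrix (Fin m) (Fin m) ℝ)).mulVec (η t))
          (((1 : Matrix (Fin n) (Fin n) ℝ) ⊗ₖ B).mulVec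
              ((P ⊗ₖ (1 : Matrix (Fin m) (Fin m) ℝ)).mulVec (η t))
            + σ • (G ⊗ₖ H).mulVec
              ((P ⊗ₖ (1 : Matrix (Fin m) (Fin m) ℝ)).mulVec (η (t - τ)))) t) := by
  have hP' : P * P⁻¹ = 1 := mul_nonsing_inv P hP
  have hinv : P⁻¹ * G = L * P⁻¹ := by
    rw [← hL, Matrix.mul_assoc _ P, hP', Matrix.mul_one]
  have hmul : P * L = G * P := by
    rw [← hL, ← Matrix.mul_assoc, ← Matrix.mul_assoc, hP', Matrix.one_mul]
  refine ⟨fun ξ hξ => ?_, fun η hη t => ?_⟩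
  · have h t := (hξ t).kronecker_one_mulVec hinv
    exact ⟨fun t => (h t).differentiableAt,
      fun i t => (hLdiag.hasDerivAt_iff_blocks B H σ τ _ t).1 (h t) i⟩
  · exact ((hLdiag.hasDerivAt_iff_blocks B H σ τ η t).2 fun i => hη i t).kronecker_one_mulVec hmul
end

section
/- Let G be an n×n complex matrix that is diagonalizable: G = P * Λ * P⁻¹ with P invertible and Λ diagonal with diagonal entries λ₁,…,λₙ. Then for any m×m complex matrices B and C and any μ ∈ ℂ, the characteristic determinant of the coupled block operator factorizes as det(μ • I_{nm} − I_n ⊗ B − G ⊗ C) = ∏ᵢ det(μ • I_m − B − λᵢ • C). -/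
open Matrix Kronecker

/-- The matrix `μ I - I ⊗ B - diagonal d ⊗ C` is block diagonal, so its determinant is the product
of the determinants of its blocks. -/
theorem det_smul_one_sub_kronecker_sub_diagonal_kronecker {ι κ R : Type*} [Fintype ι]
    [DecidableEq ι] [Fintype κ] [DecidableEq κ] [CommRing R] (d : ι → R) (B C : Matrix κ κ R)
    (μ : R) :
    (μ • (1 : Matrix (ι × κ) (ι × κ) R) - (1 : Matrix ι ι R) ⊗ₖ B - diagonal d ⊗ₖ C).det =
      ∏ i, (μ • (1 : Matrix κ κ R) - B - d i • C).det := by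
  rw [← det_blockDiagonal, ← det_reindex_self (Equiv.prodComm κ ι)]
  congr 1
  ext ⟨i, a⟩ ⟨j, b⟩
  by_cases h : i = j
  · subst h
    simp [blockDiagonal_apply, one_apply]
  · simp [blockDiagonal_apply, one_apply, h]

/-- If `G = P * L * P⁻¹` is diagonalizable with diagonal `L`, then the characteristic
determinant of the coupled block operator factorizes:
`det(μ I_{nm} - I_n ⊗ B - G ⊗ C) = ∏ᵢ det(μ I_m - B - λᵢ C)`. -/
theorem coupled_block_char_det_factorization (n m : ℕ)
    (G P L : Matrix (Fin n) (Fin n) ℂ) (hP : IsUnit P.det)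
    (hLdiag : L.IsDiag) (hG : G = P * L * P⁻¹)
    (B C : Matrix (Fin m) (Fin m) ℂ) (μ : ℂ) :
    (μ • (1 : Matrix (Fin n × Fin m) (Fin n × Fin m) ℂ)
        - (1 : Matrix (Fin n) (Fin n) ℂ) ⊗ₖ B - G ⊗ₖ C).det =
      ∏ i : Fin n, (μ • (1 : Matrix (Fin m) (Fin m) ℂ) - B - L i i • C).det := by
  have hPP : P * P⁻¹ = 1 := mul_nonsing_inv P hP
  have hconj : μ • (1 : Matrix (Fin n × Fin m) (Fin n × Fin m) ℂ)
        - (1 : Matrix (Fin n) (Fin n) ℂ) ⊗ₖ B - G ⊗ₖ C =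
      P ⊗ₖ (1 : Matrix (Fin m) (Fin m) ℂ) *
        (μ • 1 - (1 : Matrix (Fin n) (Fin n) ℂ) ⊗ₖ B - L ⊗ₖ C) *
        P⁻¹ ⊗ₖ (1 : Matrix (Fin m) (Fin m) ℂ) := by
    simp only [mul_sub, sub_mul, mul_smul_comm, smul_mul_assoc, ← mul_kronecker_mul, mul_one,
      one_mul, hPP, one_kronecker_one, hG]
  have hinv : P ⊗ₖ (1 : Matrix (Fin m) (Fin m) ℂ) * P⁻¹ ⊗ₖ (1 : Matrix (Fin m) (Fin m) ℂ) = 1 := by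
    rw [← mul_kronecker_mul, hPP, one_mul, one_kronecker_one]
  rw [hconj, det_mul_right_comm, hinv, one_mul]
  conv_lhs => rw [← hLdiag.diagonal_diag]
  exact det_smul_one_sub_kronecker_sub_diagonal_kronecker L.diag B C μ
end
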